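/- Let Y⁰ and H be commuting semisimple endomorphisms of V with integer eigenvalues. Let N̂ ∈ End(V) satisfy [Y⁰, N̂] = 0, [H, N̂] = −2N̂, and suppose that for every ℓ ≥ 0 the map N̂^ℓ restricts to an isomorphism from the ℓ-eigenspace of H onto the (−ℓ)-eigenspace of H. Let N ∈ End(V) be such that [Y⁰ + H, N] = −2N and N − N̂ lies in the sum of the j-eigenspaces of ad Y⁰ with j ≤ −2. Define W_k = ⊕_{j ≤ k} E_j(Y⁰) and W¹_k = ⊕_{j ≤ k} E_j(Y⁰ + H). Then N(W_k) ⊆ W_k and N(W¹_k) ⊆ W¹_{k−2} for all k, and for every k ∈ ℤ and every ℓ ≥ 0 the map induced by N^ℓ from Gr^{W¹}_{k+ℓ} Gr^W_k to Gr^{W¹}_{k−ℓ} Gr^W_k is an isomorphism; that is, W¹ is the relative weight filtration of N with respect to W. -/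

import Mathlib

/-- An increasing filtration of `V`: an increasing family of subspaces indexed by `ℤ`,
eventually `⊥` below and eventually `⊤` above. -/
def IsIncFilt {K V : Type} [Field K] [AddCommGroup V] [Module K V]
    (W : ℤ → Submodule K V) : Prop :=
  Monotone W ∧ (∃ a : ℤ, ∀ k ≤ a, W k = ⊥) ∧ (∃ b : ℤ, ∀ k, b ≤ k → W k = ⊤)

/-- The `j`-eigenspace `E_j(Y) = ker (Y - j·1)` of an endomorphism, for an integer `j`. -/
def intEig {K V : Type} [Field K] [AddCommGroup V] [Module K V]
    (Y : Module.End K V) (j : ℤ) : Submodule K V :=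
  LinearMap.ker (Y - (j : K) • (1 : Module.End K V))

/-- `Y` is a grading of the filtration `W`: `Y` is semisimple with integer eigenvalues
(`V` is the direct sum of the integer eigenspaces, whose mutual independence is automatic)
and `W k = ⊕_{j ≤ k} E_j(Y)` for all `k`. -/
def IsGrading {K V : Type} [Field K] [AddCommGroup V] [Module K V]
    (Y : Module.End K V) (W : ℤ → Submodule K V) : Prop :=
  (⨆ j : ℤ, intEig Y j) = ⊤ ∧ ∀ k : ℤ, W k = ⨆ j ≤ k, intEig Y j

/-- The adjoint action `ad Y = [Y, ·]` on `End(V)`. -/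
def adE {K V : Type} [Field K] [AddCommGroup V] [Module K V]
    (Y : Module.End K V) : Module.End K (Module.End K V) :=
  LinearMap.mulLeft K Y - LinearMap.mulRight K Y

/-- `M` is the relative weight filtration of `N` with respect to `W`:
`N(M_k) ⊆ M_{k-2}`, and for all `k ∈ ℤ` and `ℓ ≥ 0` the map induced by `N^ℓ` from
`Gr^M_{k+ℓ} Gr^W_k` to `Gr^M_{k-ℓ} Gr^W_k` is an isomorphism (expressed here as surjectivity
and injectivity conditions on the corresponding submodules of `V`). -/
def IsRelWeightFilt {K V : Type} [Field K] [AddCommGroup V] [Module K V]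
    (N : Module.End K V) (W M : ℤ → Submodule K V) : Prop :=
  (∀ k : ℤ, Submodule.map N (M k) ≤ M (k - 2)) ∧
  ∀ (k : ℤ) (ℓ : ℕ),
    (M (k - ℓ) ⊓ W k ≤
      Submodule.map (N ^ ℓ) (M (k + ℓ) ⊓ W k) ⊔ ((M (k - ℓ - 1) ⊓ W k) ⊔ W (k - 1))) ∧
    ((M (k + ℓ) ⊓ W k) ⊓
        Submodule.comap (N ^ ℓ) ((M (k - ℓ - 1) ⊓ W k) ⊔ W (k - 1)) ≤
      (M (k + ℓ - 1) ⊓ W k) ⊔ W (k - 1))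

/-- A one-variable Deligne system `(W, N, Y)`: `W` an increasing filtration, `N` a nilpotent
endomorphism preserving `W`, and `Y` a grading of an increasing filtration `M` of `V` such
that `Y` preserves `W`, `[Y, N] = -2N`, and `M` is the relative weight filtration of `N`
with respect to `W`. -/
def IsDeligneSystem1 {K V : Type} [Field K] [AddCommGroup V] [Module K V]
    (W : ℤ → Submodule K V) (N Y : Module.End K V) : Prop :=
  IsIncFilt W ∧ IsNilpotent N ∧ (∀ k : ℤ, Submodule.map N (W k) ≤ W k) ∧
  ∃ M : ℤ → Submodule K V, IsIncFilt M ∧ IsGrading Y M ∧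
    (∀ k : ℤ, Submodule.map Y (W k) ≤ W k) ∧ (Y * N - N * Y = -(2 • N)) ∧
    IsRelWeightFilt N W M

/-- `N₀` is the component of `N` in the `0`-eigenspace of `ad Y'`: `[Y', N₀] = 0` and
`N - N₀` lies in the sum of the nonzero integer eigenspaces of `ad Y'`. -/
def IsZeroComponent {K V : Type} [Field K] [AddCommGroup V] [Module K V]
    (Y' N N₀ : Module.End K V) : Prop :=
  adE Y' N₀ = 0 ∧
  N - N₀ ∈ ⨆ j ∈ {j : ℤ | j ≠ 0},
    LinearMap.ker (adE Y' - (j : K) • (1 : Module.End K (Module.End K V)))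

/-- `(N⁺, Y, N)` is a standard triple: `[Y, N⁺] = 2N⁺`, `[N⁺, N] = Y`, `[Y, N] = -2N`. -/
def IsStdTriple {K V : Type} [Field K] [AddCommGroup V] [Module K V]
    (Np Y N : Module.End K V) : Prop :=
  Y * Np - Np * Y = 2 • Np ∧ Np * N - N * Np = Y ∧ Y * N - N * Y = -(2 • N)

/-- `Y'` has the Deligne grading property for `(N, Y)`: there exist `N₀⁺` commuting with `Y'`
such that `(N₀⁺, Y - Y', N₀)` is a standard triple and `[N - N₀, N₀⁺] = 0`, where `N₀` is the
component of `N` in the `0`-eigenspace of `ad Y'`. -/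
def HasDGP {K V : Type} [Field K] [AddCommGroup V] [Module K V]
    (N Y Y' : Module.End K V) : Prop :=
  ∃ N₀ Np : Module.End K V, IsZeroComponent Y' N N₀ ∧ adE Y' Np = 0 ∧
    IsStdTriple Np (Y - Y') N₀ ∧ (N - N₀) * Np = Np * (N - N₀)

section IntegerEigenspaces

variable {K V : Type} [Field K] [AddCommGroup V] [Module K V]

lemma mem_intEig {Y : Module.End K V} {j : ℤ} {x : V} :
    x ∈ intEig Y j ↔ Y x = (j : K) • x := by
  simp [intEig, sub_eq_zero]

lemma intEig_eq_eigenspace (Y : Module.End K V) (j : ℤ) :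
    intEig Y j = Y.eigenspace (j : K) := by
  ext x
  rw [mem_intEig, Module.End.mem_eigenspace_iff]

lemma iSupIndep_intEig [CharZero K] (Y : Module.End K V) : iSupIndep (intEig Y) := by
  have h := (Module.End.eigenspaces_iSupIndep Y).comp (Int.cast_injective (α := K))
  convert h using 1
  ext1 j
  exact intEig_eq_eigenspace Y j

lemma disjoint_intEig_iSup_le [CharZero K] (Y : Module.End K V) {i k : ℤ} (h : k < i) :
    Disjoint (intEig Y i) (⨆ j ≤ k, intEig Y j) :=
  (iSupIndep_intEig Y i).mono_right <| iSup₂_le fun j hj =>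
    le_iSup₂_of_le j (by lia) le_rfl

/-- A subspace stable under a semisimple endomorphism with integer eigenvalues is the sum of its
intersections with the eigenspaces. -/
lemma le_of_forall_inf_intEig_le [CharZero K] [FiniteDimensional K V] {Y : Module.End K V}
    (hY : (⨆ j : ℤ, intEig Y j) = ⊤) {U T : Submodule K V} (hU : ∀ x ∈ U, Y x ∈ U)
    (h : ∀ j : ℤ, U ⊓ intEig Y j ≤ T) : U ≤ T := by
  have hdisj : ∀ μ : K, (∀ j : ℤ, (j : K) ≠ μ) → Y.eigenspace μ = ⊥ := by
    intro μ hμ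
    have := (Module.End.eigenspaces_iSupIndep Y) μ
    have htop : (⨆ ν, ⨆ (_ : ν ≠ μ), Y.eigenspace ν) = ⊤ := by
      rw [eq_top_iff, ← hY]
      exact iSup_le fun j => (intEig_eq_eigenspace Y j).le.trans
        (le_iSup₂_of_le (j : K) (hμ j) le_rfl)
    rwa [htop, disjoint_top] at this
  have htop : (⨆ μ : K, Y.genEigenspace μ 1) = ⊤ := by
    rw [eq_top_iff, ← hY]
    exact iSup_le fun j => (intEig_eq_eigenspace Y j).le.trans
      (le_iSup (fun μ : K => Y.eigenspace μ) (j : K))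
  rw [Submodule.eq_iSup_inf_genEigenspace (k := 1) (p := U) hU htop]
  refine iSup_le fun μ => ?_
  by_cases hμ : ∃ j : ℤ, (j : K) = μ
  · obtain ⟨j, rfl⟩ := hμ
    refine le_trans (le_of_eq ?_) (h j)
    rw [intEig_eq_eigenspace]
  · push Not at hμ
    refine (inf_le_right.trans (hdisj μ hμ).le).trans bot_le

lemma apply_mem_intEig_of_commute {Y A : Module.End K V} (h : Commute Y A) {i : ℤ} {x : V}
    (hx : x ∈ intEig Y i) : A x ∈ intEig Y i := by
  rw [mem_intEig] at hx ⊢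
  rw [← Module.End.mul_apply, h.eq, Module.End.mul_apply, hx, map_smul]

lemma apply_mem_intEig_add {Y A : Module.End K V} {j : ℤ} (h : Y * A - A * Y = (j : K) • A)
    {i : ℤ} {x : V} (hx : x ∈ intEig Y i) : A x ∈ intEig Y (i + j) := by
  rw [mem_intEig] at hx ⊢
  have h' := LinearMap.congr_fun h x
  simp only [LinearMap.sub_apply, Module.End.mul_apply, LinearMap.smul_apply, hx,
    map_smul] at h'
  rw [sub_eq_iff_eq_add] at h'
  rw [h', Int.cast_add, add_smul, add_comm]

/-- An endomorphism shifting the eigenspaces by `d` shifts the associated filtration by `d`. -/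
lemma apply_mem_iSup_le {Y A : Module.End K V} {d k : ℤ}
    (h : ∀ i, ∀ x ∈ intEig Y i, A x ∈ intEig Y (i + d)) {x : V}
    (hx : x ∈ ⨆ j ≤ k, intEig Y j) : A x ∈ ⨆ j ≤ k + d, intEig Y j := by
  suffices (⨆ j ≤ k, intEig Y j) ≤ (⨆ j ≤ k + d, intEig Y j).comap A from this hx
  exact iSup₂_le fun j hj y hy =>
    (le_iSup₂_of_le (f := fun (j : ℤ) (_ : j ≤ k + d) => intEig Y j) (j + d)
      (by lia) le_rfl) (h j y hy)

lemma iSup_le_intEig_mono (Y : Module.End K V) : Monotone fun k : ℤ => ⨆ j ≤ k, intEig Y j :=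
  fun _ _ hab => iSup₂_le fun j hj => le_iSup₂_of_le j (hj.trans hab) le_rfl

/-- An endomorphism in the sum of the `j`-eigenspaces of `ad Y` with `j ≤ d` shifts the filtration
attached to `Y` by `d`. -/
lemma apply_mem_of_mem_iSup_ad {Y D : Module.End K V} {d : ℤ}
    (hD : D ∈ ⨆ j ∈ {j : ℤ | j ≤ d},
      LinearMap.ker (adE Y - (j : K) • (1 : Module.End K (Module.End K V))))
    {k : ℤ} {x : V} (hx : x ∈ ⨆ j ≤ k, intEig Y j) : D x ∈ ⨆ j ≤ k + d, intEig Y j := by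
  suffices (⨆ j ∈ {j : ℤ | j ≤ d},
      LinearMap.ker (adE Y - (j : K) • (1 : Module.End K (Module.End K V)))) ≤
      (⨆ j ≤ k + d, intEig Y j).comap (LinearMap.applyₗ x) from this hD
  refine iSup₂_le fun j hj A hA => ?_
  have hA' : Y * A - A * Y = (j : K) • A := by
    simpa [adE, sub_eq_zero] using hA
  have hj' : j ≤ d := hj
  exact iSup_le_intEig_mono Y (by lia : k + j ≤ k + d)
    (apply_mem_iSup_le (fun i y hy => apply_mem_intEig_add hA' hy) hx)

lemma iSup_intEig_add_eq_top [CharZero K] [FiniteDimensional K V] {Y H : Module.End K V}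
    (hY : (⨆ j : ℤ, intEig Y j) = ⊤) (hH : (⨆ j : ℤ, intEig H j) = ⊤) (hYH : Commute Y H) :
    (⨆ j : ℤ, intEig (Y + H) j) = ⊤ := by
  rw [eq_top_iff]
  refine le_of_forall_inf_intEig_le hY (fun _ _ => trivial) fun i => ?_
  refine le_of_forall_inf_intEig_le hH
    (fun x hx => ⟨trivial, apply_mem_intEig_of_commute hYH hx.2⟩) fun j x hx => ?_
  refine (le_iSup (intEig (Y + H)) (i + j)) ?_
  have h1 := mem_intEig.1 hx.1.2
  have h2 := mem_intEig.1 hx.2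
  rw [mem_intEig, LinearMap.add_apply, h1, h2, Int.cast_add, add_smul]

/-- The intersection of the filtrations of two commuting gradings is the sum of the joint
eigenspaces it contains. -/
lemma iSup_le_inf_iSup_le_le [CharZero K] [FiniteDimensional K V] {Y Z : Module.End K V}
    (hY : (⨆ j : ℤ, intEig Y j) = ⊤) (hZ : (⨆ j : ℤ, intEig Z j) = ⊤) (hYZ : Commute Y Z)
    {a b : ℤ} {T : Submodule K V}
    (h : ∀ i ≤ a, ∀ j ≤ b, intEig Y i ⊓ intEig Z j ≤ T) :
    (⨆ j ≤ b, intEig Z j) ⊓ (⨆ i ≤ a, intEig Y i) ≤ T := by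
  have stable : ∀ {A B : Module.End K V} {c : ℤ}, Commute A B →
      ∀ x ∈ ⨆ i ≤ c, intEig A i, B x ∈ ⨆ i ≤ c, intEig A i := by
    intro A B c hAB x hx
    simpa using apply_mem_iSup_le (d := 0)
      (fun i y hy => by simpa using apply_mem_intEig_of_commute hAB hy) hx
  refine le_of_forall_inf_intEig_le hY
    (fun x hx => ⟨stable hYZ.symm x hx.1, stable (Commute.refl Y) x hx.2⟩) fun i => ?_
  refine le_of_forall_inf_intEig_le hZ
    (fun x hx => ⟨⟨stable (Commute.refl Z) x hx.1.1, stable hYZ x hx.1.2⟩,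
      apply_mem_intEig_of_commute hYZ hx.2⟩) fun j x hx => ?_
  obtain ⟨⟨⟨hxZ, hxY⟩, hxi⟩, hxj⟩ := hx
  by_cases hi : i ≤ a
  · by_cases hj : j ≤ b
    · exact h i hi j hj ⟨hxi, hxj⟩
    · have := (disjoint_intEig_iSup_le Z (not_le.1 hj)).le_bot ⟨hxj, hxZ⟩
      exact (bot_le : ⊥ ≤ T) this
  · have := (disjoint_intEig_iSup_le Y (not_le.1 hi)).le_bot ⟨hxi, hxY⟩
    exact (bot_le : ⊥ ≤ T) this

/-- Modulo a stable subspace, an eigenspace still meets the sum of the eigenspaces for smaller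
eigenvalues trivially. -/
lemma mem_of_mem_intEig_of_mem_sup [CharZero K] {Z : Module.End K V} {U : Submodule K V}
    (hU : ∀ x ∈ U, Z x ∈ U) {c d : ℤ} (hd : d < c) {x : V} (hx : x ∈ intEig Z c)
    (hx' : x ∈ (⨆ j ≤ d, intEig Z j) ⊔ U) : x ∈ U := by
  let Zq : Module.End K (V ⧸ U) := U.mapQ U Z hU
  have hq : ∀ (j : ℤ), intEig Z j ≤ (intEig Zq j).comap U.mkQ := by
    intro j y hy
    rw [mem_intEig] at hy
    rw [Submodule.mem_comap, mem_intEig]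
    simp [Zq, hy]
  have h2 : (⨆ j ≤ d, intEig Z j) ⊔ U ≤ (⨆ j ≤ d, intEig Zq j).comap U.mkQ := by
    refine sup_le (iSup₂_le fun j hj => (hq j).trans (Submodule.comap_mono
      (le_iSup₂_of_le j hj le_rfl))) ?_
    intro y hy
    have : U.mkQ y = 0 := by simpa using hy
    rw [Submodule.mem_comap, this]
    exact zero_mem _
  have := (disjoint_intEig_iSup_le Zq hd).le_bot ⟨hq c hx, h2 hx'⟩
  simpa using this

end IntegerEigenspaces

/-- Let `Y⁰, H` be commuting semisimple endomorphisms with integer eigenvalues,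
`N̂` with `[Y⁰, N̂] = 0`, `[H, N̂] = -2N̂` and `N̂^ℓ : E_ℓ(H) ≅ E_{-ℓ}(H)` for all `ℓ ≥ 0`,
and `N` with `[Y⁰ + H, N] = -2N` and `N - N̂` in the sum of the `j`-eigenspaces of `ad Y⁰`
with `j ≤ -2`.  With `W_k = ⊕_{j ≤ k} E_j(Y⁰)` and `W¹_k = ⊕_{j ≤ k} E_j(Y⁰ + H)`, `N`
preserves `W`, and `W¹` is the relative weight filtration of `N` with respect to `W`
(so `N(W¹_k) ⊆ W¹_{k-2}` and the induced maps `N^ℓ : Gr^{W¹}_{k+ℓ} Gr^W_k →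
Gr^{W¹}_{k-ℓ} Gr^W_k` are isomorphisms). -/
theorem stmt14 {K V : Type} [Field K] [CharZero K] [AddCommGroup V] [Module K V]
    [FiniteDimensional K V]
    (Y0 H : Module.End K V)
    (hY0ss : (⨆ j : ℤ, intEig Y0 j) = ⊤)
    (hHss : (⨆ j : ℤ, intEig H j) = ⊤)
    (hYH : Y0 * H = H * Y0)
    (Nh : Module.End K V)
    (hNhY0 : Y0 * Nh = Nh * Y0)
    (hNhH : H * Nh - Nh * H = -(2 • Nh))
    (hNhiso : ∀ ℓ : ℕ,
      Submodule.map (Nh ^ ℓ) (intEig H (ℓ : ℤ)) = intEig H (-(ℓ : ℤ)) ∧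
      Disjoint (LinearMap.ker (Nh ^ ℓ)) (intEig H (ℓ : ℤ)))
    (N : Module.End K V)
    (hN : (Y0 + H) * N - N * (Y0 + H) = -(2 • N))
    (hNNh : N - Nh ∈ ⨆ j ∈ {j : ℤ | j ≤ -2},
      LinearMap.ker (adE Y0 - (j : K) • (1 : Module.End K (Module.End K V))))
    (W W1 : ℤ → Submodule K V)
    (hW : ∀ k : ℤ, W k = ⨆ j ≤ k, intEig Y0 j)
    (hW1 : ∀ k : ℤ, W1 k = ⨆ j ≤ k, intEig (Y0 + H) j) :
    (∀ k : ℤ, Submodule.map N (W k) ≤ W k) ∧ IsRelWeightFilt N W W1 := by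
  have hYY1 : Commute Y0 (Y0 + H) := (Commute.refl Y0).add_right hYH
  have hY1ss := iSup_intEig_add_eq_top hY0ss hHss hYH
  have hWm : Monotone W := by
    have := iSup_le_intEig_mono Y0
    rwa [← funext hW] at this
  have hEW : ∀ {i k : ℤ}, i ≤ k → intEig Y0 i ≤ W k := fun {i k} h => by
    rw [hW]; exact le_iSup₂_of_le i h le_rfl
  have hEW1 : ∀ {i k : ℤ}, i ≤ k → intEig (Y0 + H) i ≤ W1 k := fun {i k} h => by
    rw [hW1]; exact le_iSup₂_of_le i h le_rfl
  have hWstable : ∀ {A : Module.End K V}, Commute Y0 A → ∀ k, ∀ x ∈ W k, A x ∈ W k := by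
    intro A hA k x hx
    rw [hW] at hx ⊢
    simpa using apply_mem_iSup_le (d := 0)
      (fun i y hy => by simpa using apply_mem_intEig_of_commute hA hy) hx
  have hDW : ∀ k, ∀ x ∈ W k, (N - Nh) x ∈ W (k - 1) := by
    intro k x hx
    apply hWm (by lia : k + -2 ≤ k - 1)
    rw [hW] at hx ⊢
    exact apply_mem_of_mem_iSup_ad hNNh hx
  have hNW : ∀ k, ∀ x ∈ W k, N x ∈ W k := by
    intro k x hx
    have := add_mem (hWm (by lia) (hDW k x hx)) (hWstable hNhY0 k x hx)
    simpa using this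
  have hNW1 : ∀ k, ∀ x ∈ W1 k, N x ∈ W1 (k - 2) := by
    intro k x hx
    rw [hW1] at hx ⊢
    have hN' : (Y0 + H) * N - N * (Y0 + H) = ((-2 : ℤ) : K) • N := by
      rw [hN, Int.cast_smul_eq_zsmul, neg_smul, two_nsmul, two_zsmul]
    exact apply_mem_iSup_le (fun i y hy => apply_mem_intEig_add hN' hy) hx
  have hNpowW : ∀ (ℓ : ℕ) k, ∀ x ∈ W k, (N ^ ℓ) x ∈ W k := by
    intro ℓ k x hx
    exact Module.End.pow_apply_mem_of_forall_mem ℓ (hNW k) x hx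
  have hNpowW1 : ∀ (ℓ : ℕ) k, ∀ x ∈ W1 k, (N ^ ℓ) x ∈ W1 (k - 2 * ℓ) := by
    intro ℓ k x hx
    induction ℓ with
    | zero => simpa using hx
    | succ ℓ ih =>
      rw [pow_succ', Module.End.mul_apply]
      convert hNW1 _ _ ih using 2
      push_cast
      ring
  have hpow : ∀ (ℓ : ℕ) k, ∀ x ∈ W k, (N ^ ℓ) x - (Nh ^ ℓ) x ∈ W (k - 1) := by
    intro ℓ k x hx
    induction ℓ with
    | zero => simp
    | succ ℓ ih =>
      have h1 := hNW _ _ ih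
      have h2 := hDW k _ (hWstable (Commute.pow_right hNhY0 ℓ) k x hx)
      have := add_mem h1 h2
      simpa [pow_succ', Module.End.mul_apply] using this
  have hsplit : ∀ k c : ℤ, W1 c ⊓ W k ≤
      (intEig Y0 k ⊓ intEig (Y0 + H) c) ⊔ ((W1 (c - 1) ⊓ W k) ⊔ W (k - 1)) := by
    intro k c
    have := iSup_le_inf_iSup_le_le hY0ss hY1ss hYY1 (a := k) (b := c)
      (T := (intEig Y0 k ⊓ intEig (Y0 + H) c) ⊔ ((W1 (c - 1) ⊓ W k) ⊔ W (k - 1)))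
    rw [← hW, ← hW1] at this
    refine this fun i hi j hj => ?_
    rcases hi.lt_or_eq with hi' | rfl
    · exact (inf_le_left.trans (hEW (by lia))).trans (le_sup_right.trans le_sup_right)
    · rcases hj.lt_or_eq with hj' | rfl
      · exact (inf_le_inf (hEW le_rfl) (hEW1 (by lia))).trans
          ((inf_comm _ _).le.trans (le_sup_left.trans le_sup_right))
      · exact le_sup_left
  have hjoint : ∀ {k c x}, x ∈ intEig Y0 k → (x ∈ intEig (Y0 + H) (k + c) ↔ x ∈ intEig H c) := by
    intro k c x hx
    rw [mem_intEig] at hx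
    rw [mem_intEig, mem_intEig, LinearMap.add_apply, hx, Int.cast_add, add_smul, add_right_inj]
  refine ⟨fun k => Submodule.map_le_iff_le_comap.2 (hNW k),
    fun k => Submodule.map_le_iff_le_comap.2 (hNW1 k), fun k ℓ => ⟨?_, ?_⟩⟩
  · refine (hsplit k (k - ℓ)).trans (sup_le ?_ le_sup_right)
    rintro x ⟨hx0, hx1⟩
    rw [SetLike.mem_coe, sub_eq_add_neg, hjoint hx0, ← (hNhiso ℓ).1] at hx1
    obtain ⟨y, hy, rfl⟩ := hx1
    have hyH : y ∈ intEig H ℓ := hy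
    have hcomm : Commute Y0 (Nh ^ ℓ) := Commute.pow_right hNhY0 ℓ
    have hy0 : y ∈ intEig Y0 k := by
      have hker : Y0 y - (k : K) • y ∈ LinearMap.ker (Nh ^ ℓ) := by
        rw [LinearMap.mem_ker, map_sub, map_smul, ← Module.End.mul_apply, ← hcomm.eq,
          Module.End.mul_apply, mem_intEig.1 hx0, sub_self]
      have hmem : Y0 y - (k : K) • y ∈ intEig H ℓ :=
        sub_mem (apply_mem_intEig_of_commute (Commute.symm hYH) hyH) (Submodule.smul_mem _ _ hyH)
      have := (hNhiso ℓ).2.le_bot ⟨hker, hmem⟩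
      rwa [Submodule.mem_bot, sub_eq_zero, ← mem_intEig] at this
    have hyW := hEW le_rfl hy0
    have hyW1 := hEW1 le_rfl ((hjoint hy0).2 hyH)
    rw [← sub_sub_cancel ((N ^ ℓ) y) ((Nh ^ ℓ) y)]
    exact sub_mem (Submodule.mem_sup_left ⟨y, ⟨hyW1, hyW⟩, rfl⟩)
      (Submodule.mem_sup_right (Submodule.mem_sup_right (hpow ℓ k y hyW)))
  · rintro x ⟨hx, hNx⟩
    obtain ⟨x₀, ⟨hx₀, hx₁⟩, r, hr, rfl⟩ := Submodule.mem_sup.1 (hsplit k (k + ℓ) hx)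
    have hNr : (N ^ ℓ) r ∈ (W1 (k - ℓ - 1) ⊓ W k) ⊔ W (k - 1) := by
      obtain ⟨r₁, hr₁, r₂, hr₂, rfl⟩ := Submodule.mem_sup.1 hr
      rw [map_add]
      refine Submodule.add_mem_sup ⟨?_, hNpowW ℓ _ _ hr₁.2⟩ (hNpowW ℓ _ _ hr₂)
      have := hNpowW1 ℓ _ _ hr₁.1
      rwa [show k + (ℓ : ℤ) - 1 - 2 * ℓ = k - ℓ - 1 by ring] at this
    have hNhx : (Nh ^ ℓ) x₀ ∈ (W1 (k - ℓ - 1) ⊓ W k) ⊔ W (k - 1) := by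
      have h1 : (N ^ ℓ) x₀ ∈ (W1 (k - ℓ - 1) ⊓ W k) ⊔ W (k - 1) := by
        have := sub_mem (Submodule.mem_comap.1 hNx) hNr
        simpa using this
      have := sub_mem h1 (Submodule.mem_sup_right (hpow ℓ k x₀ (hEW le_rfl hx₀)))
      simpa using this
    have hx₀H : x₀ ∈ intEig H ℓ := (hjoint hx₀).1 hx₁
    have hNhk : (Nh ^ ℓ) x₀ ∈ intEig Y0 k :=
      apply_mem_intEig_of_commute (Commute.pow_right hNhY0 ℓ) hx₀
    have hNhc : (Nh ^ ℓ) x₀ ∈ intEig (Y0 + H) (k + -ℓ) := by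
      rw [hjoint hNhk, ← (hNhiso ℓ).1]
      exact Submodule.mem_map_of_mem hx₀H
    have hlow : (Nh ^ ℓ) x₀ ∈ W (k - 1) := by
      refine mem_of_mem_intEig_of_mem_sup (hWstable hYY1 (k - 1))
        (by lia : k - ℓ - 1 < k + -ℓ) hNhc ?_
      rw [← hW1]
      exact (sup_le_sup_right inf_le_left _ : _ ≤ W1 (k - ℓ - 1) ⊔ W (k - 1)) hNhx
    rw [hW] at hlow
    have hzero : (Nh ^ ℓ) x₀ = 0 := by
      simpa using (disjoint_intEig_iSup_le Y0 (by lia : k - 1 < k)).le_bot ⟨hNhk, hlow⟩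
    have hx₀0 : x₀ = 0 := by
      simpa using (hNhiso ℓ).2.le_bot ⟨LinearMap.mem_ker.2 hzero, hx₀H⟩
    rwa [hx₀0, zero_add]
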